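/- Let (n,d,m) be one of the triples: (2,d,−1) with 5 ≤ d ≤ 14; (4,4,−1), (4,5,−1), (4,6,−1), (4,5,0), (4,6,0); (6,3,−1), (6,4,−1), (6,4,0); (8,3,−1), (8,3,0); (10,3,−1), (10,3,0), (10,3,1). Then for all nonzero integers r and ř, the rank of the matrix r·[P_{i+j}] + ř·[(P̌_m)_{i+j}] equals K^d_n(m) := 2·C_{1^{n/2+1},(d−1)^{n/2+1}} − C_{1^{n−m+1},(d−1)^{m+1}}. -/

import Mathlib

open Finset Matrix

/-- `ζ_{2d} = exp(2πi/(2d))`. -/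
noncomputable def zeta2d (d : ℕ) : ℂ :=
  Complex.exp (2 * Real.pi * Complex.I / (2 * (d : ℂ)))

/-- The even-position index `2e` in `{0,…,n+1}` (with `n = 2h`). -/
def evIdx (h : ℕ) (e : Fin (h + 1)) : Fin (2 * h + 2) :=
  ⟨2 * e.1, by have := e.isLt; omega⟩

/-- The odd-position index `2e+1` in `{0,…,n+1}` (with `n = 2h`). -/
def odIdx (h : ℕ) (e : Fin (h + 1)) : Fin (2 * h + 2) :=
  ⟨2 * e.1 + 1, by have := e.isLt; omega⟩

/-- The index set `I_N`: tuples `(i_0,…,i_{n+1})` with `0 ≤ i_e ≤ d-2` and `∑ i_e = N`,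
for `n = 2h` even. -/
abbrev IdxSet (h d N : ℕ) : Type :=
  {i : Fin (2 * h + 2) → Fin (d - 1) // ∑ e, (i e).1 = N}

/-- The period vector `p^{a,b}` of the linear cycle `ℙ^{n/2}_{a,b}` in the Fermat variety,
extended by zero to all integer tuples. -/
noncomputable def pvec (h d : ℕ) (a : Fin (h + 1) → ℕ) (b : Equiv.Perm (Fin (2 * h + 2)))
    (i : Fin (2 * h + 2) → ℕ) : ℂ :=
  if ∀ e : Fin (h + 1), i (b (evIdx h e)) + i (b (odIdx h e)) = d - 2 then
    zeta2d d ^ (∑ e : Fin (h + 1), (i (b (evIdx h e)) + 1) * (1 + 2 * a e))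
  else 0

/-- The period matrix `[p_{i+j}]` with rows indexed by `I_{(n/2)d-n-2}` and columns by `I_d`. -/
noncomputable def pmat (h d : ℕ) (p : (Fin (2 * h + 2) → ℕ) → ℂ) :
    Matrix (IdxSet h d (h * d - (2 * h + 2))) (IdxSet h d d) ℂ :=
  Matrix.of fun i j => p fun e => (i.1 e).1 + (j.1 e).1

/-- The period vector `P` of the linear cycle with `a = (0,…,0)` and `b = id`. -/
noncomputable def Pvec (h d : ℕ) : (Fin (2 * h + 2) → ℕ) → ℂ :=
  pvec h d (fun _ => 0) (Equiv.refl _)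

/-- The period vector `P̌_m` (with `μ = m+1`): `a` has first `μ` entries `0`, the rest `1`,
and `b = id`. -/
noncomputable def PcheckVec (h d μ : ℕ) : (Fin (2 * h + 2) → ℕ) → ℂ :=
  pvec h d (fun e => if e.1 < μ then 0 else 1) (Equiv.refl _)

/-- The combinatorial constant `C_{α_1,…,α_s}`. -/
def Ccoef (n d : ℕ) {s : ℕ} (α : Fin s → ℕ) : ℤ :=
  ((n + 1 + d).choose (n + 1) : ℤ) -
    ∑ k ∈ Finset.Icc 1 s, (-1 : ℤ) ^ (k - 1) *
      ∑ T ∈ Finset.univ.filter (fun T : Finset (Fin s) => T.card = k ∧ ∑ i ∈ T, α i ≤ d),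
        (((n + 1 + d - ∑ i ∈ T, α i).choose (n + 1) : ℤ))

/-- The sequence `x^s, y^t` (x repeated s times followed by y repeated t times). -/
def twoBlock (x y s t : ℕ) : Fin (s + t) → ℕ := fun i => if i.1 < s then x else y

/-- `K^d_n(m) = 2·C_{1^{n/2+1},(d-1)^{n/2+1}} − C_{1^{n−m+1},(d−1)^{m+1}}`, with `n = 2h`,
`μ = m+1`. -/
def Kdef (h d μ : ℕ) : ℤ :=
  2 * Ccoef (2 * h) d (twoBlock 1 (d - 1) (h + 1) (h + 1)) -
    Ccoef (2 * h) d (twoBlock 1 (d - 1) (2 * h + 2 - μ) μ)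

/-- The list of triples `(n,d,m)` of Theorem `27.03.17`, encoded as `(h, d, μ)` with
`n = 2h` and `μ = m+1`. -/
def TripleList (h d μ : ℕ) : Prop :=
  (h = 1 ∧ 5 ≤ d ∧ d ≤ 14 ∧ μ = 0) ∨
  (h = 2 ∧ ((d = 4 ∧ μ = 0) ∨ (d = 5 ∧ μ = 0) ∨ (d = 6 ∧ μ = 0) ∨
            (d = 5 ∧ μ = 1) ∨ (d = 6 ∧ μ = 1))) ∨
  (h = 3 ∧ ((d = 3 ∧ μ = 0) ∨ (d = 4 ∧ μ = 0) ∨ (d = 4 ∧ μ = 1))) ∨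
  (h = 4 ∧ d = 3 ∧ (μ = 0 ∨ μ = 1)) ∨
  (h = 5 ∧ d = 3 ∧ (μ = 0 ∨ μ = 1 ∨ μ = 2))

theorem sum_pairs (h : ℕ) (f : Fin (2 * h + 2) → ℕ) :
    ∑ t, f t = ∑ e, (f (evIdx h e) + f (odIdx h e)) := by
  induction h with
  | zero => simp [evIdx, odIdx, Fin.sum_univ_two]
  | succ h ih =>
    rw [Fin.sum_univ_castSucc (n := h + 1)]
    have h1 := ih (fun t => f (Fin.castSucc (Fin.castSucc t)))
    have h2 : ∑ t, f t = (∑ t : Fin (2 * h + 2), f (Fin.castSucc (Fin.castSucc t)))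
        + f (Fin.castSucc (Fin.last (2 * h + 2))) + f (Fin.last (2 * h + 3)) := by
      have e1 := Fin.sum_univ_castSucc (n := 2 * h + 3) f
      have e2 := Fin.sum_univ_castSucc (n := 2 * h + 2) (fun t => f (Fin.castSucc t))
      exact e1.trans (by rw [e2])
    refine h2.trans ?_
    rw [h1, add_assoc]
    rfl

/-- Interleave two tuples. -/
def interl (h : ℕ) (p q : Fin (h + 1) → ℕ) (t : Fin (2 * h + 2)) : ℕ :=
  if t.1 % 2 = 0 then p ⟨t.1 / 2, by have := t.isLt; omega⟩
  else q ⟨t.1 / 2, by have := t.isLt; omega⟩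

theorem interl_ev (h : ℕ) (p q : Fin (h + 1) → ℕ) (e : Fin (h + 1)) :
    interl h p q (evIdx h e) = p e := by
  simp [interl, evIdx]

theorem interl_od (h : ℕ) (p q : Fin (h + 1) → ℕ) (e : Fin (h + 1)) :
    interl h p q (odIdx h e) = q e := by
  have h1 : (2 * e.1 + 1) % 2 = 1 := by omega
  have h2 : (2 * e.1 + 1) / 2 = e.1 := by omega
  simp [interl, odIdx, h1, h2]

theorem interl_lt (h c : ℕ) (p q : Fin (h + 1) → ℕ) (hp : ∀ e, p e < c) (hq : ∀ e, q e < c)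
    (t : Fin (2 * h + 2)) : interl h p q t < c := by
  unfold interl
  split_ifs
  · exact hp _
  · exact hq _

/-- The tuples of pair sums of the columns. -/
abbrev VSet (h d : ℕ) : Type := {v : Fin (h + 1) → Fin (d - 1) // ∑ e, (v e).1 = d}

/-- Rows and columns from pairs. -/
def mkIdx (h d N : ℕ) (p q : Fin (h + 1) → ℕ) (hp : ∀ e, p e < d - 1) (hq : ∀ e, q e < d - 1)
    (hs : ∑ e, (p e + q e) = N) : IdxSet h d N :=
  ⟨fun t => ⟨interl h p q t, interl_lt h _ p q hp hq t⟩, by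
    simp only [sum_pairs, interl_ev, interl_od, hs]⟩

theorem mkIdx_ev (h d N : ℕ) (p q : Fin (h + 1) → ℕ) (hp : ∀ e, p e < d - 1)
    (hq : ∀ e, q e < d - 1) (hs : ∑ e, (p e + q e) = N) (e : Fin (h + 1)) :
    ((mkIdx h d N p q hp hq hs).1 (evIdx h e)).1 = p e := interl_ev h p q e

theorem mkIdx_od (h d N : ℕ) (p q : Fin (h + 1) → ℕ) (hp : ∀ e, p e < d - 1)
    (hq : ∀ e, q e < d - 1) (hs : ∑ e, (p e + q e) = N) (e : Fin (h + 1)) :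
    ((mkIdx h d N p q hp hq hs).1 (odIdx h e)).1 = q e := interl_od h p q e

theorem zeta2d_prim (d : ℕ) (hd : d ≠ 0) : IsPrimitiveRoot (zeta2d d) (2 * d) := by
  have := Complex.isPrimitiveRoot_exp (2 * d) (by omega)
  unfold zeta2d
  push_cast at this
  exact this

theorem zeta2d_ne (d : ℕ) : zeta2d d ≠ 0 := Complex.exp_ne_zero _

theorem zeta2d_sq_ne (d : ℕ) (hd : 3 ≤ d) : zeta2d d ^ 2 - 1 ≠ 0 := by
  intro h0
  have h1 := (zeta2d_prim d (by omega)).dvd_of_pow_eq_one 2 (by linear_combination h0)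
  have := Nat.le_of_dvd (by norm_num) h1
  omega

/-- The combined matrix. -/
noncomputable def combM (h d μ : ℕ) (r rc : ℤ) :
    Matrix (IdxSet h d (h * d - (2 * h + 2))) (IdxSet h d d) ℂ :=
  (r : ℂ) • pmat h d (Pvec h d) + (rc : ℂ) • pmat h d (PcheckVec h d μ)

/-- The exponent weights: `k = 0` for `P`, `k = 1` for `P̌`. -/
def wt (h μ : ℕ) (k : Fin 2) (e : Fin (h + 1)) : ℕ :=
  if k = 0 then 0 else if e.1 < μ then 0 else 1

theorem combM_apply (h d μ : ℕ) (r rc : ℤ) (i j) :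
    combM h d μ r rc i j =
      if ∀ e : Fin (h + 1), ((i.1 (evIdx h e)).1 + (j.1 (evIdx h e)).1) +
          ((i.1 (odIdx h e)).1 + (j.1 (odIdx h e)).1) = d - 2 then
        (r : ℂ) * zeta2d d ^ (∑ e : Fin (h + 1),
          ((i.1 (evIdx h e)).1 + (j.1 (evIdx h e)).1 + 1) * (1 + 2 * wt h μ 0 e)) +
        (rc : ℂ) * zeta2d d ^ (∑ e : Fin (h + 1),
          ((i.1 (evIdx h e)).1 + (j.1 (evIdx h e)).1 + 1) * (1 + 2 * wt h μ 1 e))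
      else 0 := by
  have h0 : combM h d μ r rc i j =
      (r : ℂ) * pvec h d (wt h μ 0) (Equiv.refl _) (fun e => (i.1 e).1 + (j.1 e).1) +
      (rc : ℂ) * pvec h d (wt h μ 1) (Equiv.refl _) (fun e => (i.1 e).1 + (j.1 e).1) := rfl
  rw [h0]
  by_cases hc : ∀ e : Fin (h + 1), ((i.1 (evIdx h e)).1 + (j.1 (evIdx h e)).1) +
          ((i.1 (odIdx h e)).1 + (j.1 (odIdx h e)).1) = d - 2
  · have h1 : ∀ a, pvec h d a (Equiv.refl _) (fun e => (i.1 e).1 + (j.1 e).1) = zeta2d d ^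
        (∑ e : Fin (h + 1), ((i.1 (evIdx h e)).1 + (j.1 (evIdx h e)).1 + 1) * (1 + 2 * a e)) :=
      fun a => if_pos hc
    rw [if_pos hc, h1, h1]
  · have h1 : ∀ a, pvec h d a (Equiv.refl _) (fun e => (i.1 e).1 + (j.1 e).1) = 0 :=
      fun a => if_neg hc
    rw [if_neg hc, h1, h1]
    simp

theorem combM_rank_le (h d μ : ℕ) (r rc : ℤ) :
    (combM h d μ r rc).rank ≤ 2 * Fintype.card (VSet h d) := by
  classical
  let A : Matrix (IdxSet h d (h * d - (2 * h + 2))) (VSet h d × Fin 2) ℂ := Matrix.of fun i vk =>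
    if ∀ e : Fin (h + 1), (i.1 (evIdx h e)).1 + (i.1 (odIdx h e)).1 + (vk.1.1 e).1 = d - 2 then
      (if vk.2 = 0 then (r : ℂ) else rc) * zeta2d d ^ (∑ e : Fin (h + 1),
          ((i.1 (evIdx h e)).1 + 1) * (1 + 2 * wt h μ vk.2 e)) else 0
  let B : Matrix (VSet h d × Fin 2) (IdxSet h d d) ℂ := Matrix.of fun vk j =>
    if ∀ e : Fin (h + 1), (j.1 (evIdx h e)).1 + (j.1 (odIdx h e)).1 = (vk.1.1 e).1 then
      zeta2d d ^ (∑ e : Fin (h + 1),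
          ((j.1 (evIdx h e)).1) * (1 + 2 * wt h μ vk.2 e)) else 0
  have hAB : combM h d μ r rc = A * B := by
    ext i j
    rw [combM_apply, Matrix.mul_apply, Fintype.sum_prod_type]
    by_cases hlt : ∀ e : Fin (h + 1), (j.1 (evIdx h e)).1 + (j.1 (odIdx h e)).1 < d - 1
    · let v0 : VSet h d := ⟨fun e => ⟨_, hlt e⟩, by
        rw [← sum_pairs h (fun t => (j.1 t).1)]; exact j.2⟩
      rw [Finset.sum_eq_single v0]
      · have hB : ∀ e : Fin (h + 1), (j.1 (evIdx h e)).1 + (j.1 (odIdx h e)).1 = (v0.1 e).1 :=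
          fun e => rfl
        simp only [Fin.sum_univ_two, A, B, Matrix.of_apply, if_pos hB]
        have hiff : (∀ e : Fin (h + 1), ((i.1 (evIdx h e)).1 + (j.1 (evIdx h e)).1) +
          ((i.1 (odIdx h e)).1 + (j.1 (odIdx h e)).1) = d - 2) ↔
          ∀ e : Fin (h + 1), (i.1 (evIdx h e)).1 + (i.1 (odIdx h e)).1 + (v0.1 e).1 = d - 2 := by
          refine forall_congr' fun e => ?_
          rw [← hB e]
          omega
        by_cases hc : ∀ e : Fin (h + 1),
            (i.1 (evIdx h e)).1 + (i.1 (odIdx h e)).1 + (v0.1 e).1 = d - 2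
        · rw [if_pos (hiff.2 hc), if_pos hc, if_pos hc]
          have key : ∀ k, zeta2d d ^ (∑ e : Fin (h + 1),
              ((i.1 (evIdx h e)).1 + (j.1 (evIdx h e)).1 + 1) * (1 + 2 * wt h μ k e)) =
              zeta2d d ^ (∑ e : Fin (h + 1), ((i.1 (evIdx h e)).1 + 1) * (1 + 2 * wt h μ k e)) *
              zeta2d d ^ (∑ e : Fin (h + 1), ((j.1 (evIdx h e)).1) * (1 + 2 * wt h μ k e)) := by
            intro k
            rw [← pow_add, ← Finset.sum_add_distrib]
            congr 1
            refine Finset.sum_congr rfl fun e _ => ?_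
            ring
          rw [key 0, key 1]
          simp [mul_assoc]
        · rw [if_neg (fun hh => hc (hiff.1 hh)), if_neg hc, if_neg hc]
          simp
      · intro v _ hv
        refine Finset.sum_eq_zero fun k _ => ?_
        have : ¬ ∀ e : Fin (h + 1), (j.1 (evIdx h e)).1 + (j.1 (odIdx h e)).1 = (v.1 e).1 := by
          intro hh
          apply hv
          apply Subtype.ext
          funext e
          exact Fin.ext (hh e).symm
        simp only [B, Matrix.of_apply, if_neg this, mul_zero]
      · simp
    · rw [if_neg, Finset.sum_eq_zero]
      · intro v _
        refine Finset.sum_eq_zero fun k _ => ?_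
        have : ¬ ∀ e : Fin (h + 1), (j.1 (evIdx h e)).1 + (j.1 (odIdx h e)).1 = (v.1 e).1 := by
          intro hh
          exact hlt fun e => by rw [hh e]; exact (v.1 e).2
        simp only [B, Matrix.of_apply, if_neg this, mul_zero]
      · intro hh
        apply hlt
        intro e
        have := hh e
        have := (j.1 (evIdx h e)).2
        omega
  rw [hAB]
  refine (Matrix.rank_mul_le_left A B).trans ((Matrix.rank_le_card_width A).trans ?_)
  simp [mul_comm]

/-- The constant two by two block. -/
noncomputable def Qmat (h d μ : ℕ) (r rc : ℤ) : Matrix (Fin 2) (Fin 2) ℂ := Matrix.of fun k l =>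
  (r : ℂ) * (zeta2d d ^ (∑ e : Fin (h + 1), (1 + 2 * wt h μ 0 e)) * zeta2d d ^ (k.1 + l.1)) +
  (rc : ℂ) * (zeta2d d ^ (∑ e : Fin (h + 1), (1 + 2 * wt h μ 1 e)) * zeta2d d ^ (3 * (k.1 + l.1)))

theorem Qmat_det (h d μ : ℕ) (r rc : ℤ) (hr : r ≠ 0) (hrc : rc ≠ 0) (hd : 3 ≤ d) :
    (Qmat h d μ r rc).det ≠ 0 := by
  have : (Qmat h d μ r rc).det = (r : ℂ) * rc *
      zeta2d d ^ (∑ e : Fin (h + 1), (1 + 2 * wt h μ 0 e)) *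
      zeta2d d ^ (∑ e : Fin (h + 1), (1 + 2 * wt h μ 1 e)) * zeta2d d ^ 2 *
      (zeta2d d ^ 2 - 1) ^ 2 := by
    rw [Matrix.det_fin_two]
    simp only [Qmat, Matrix.of_apply, Fin.val_zero, Fin.val_one]
    ring
  rw [this]
  have hz := zeta2d_ne d
  have h1 : (r : ℂ) ≠ 0 := by exact_mod_cast hr
  have h2 : (rc : ℂ) ≠ 0 := by exact_mod_cast hrc
  have h3 := zeta2d_sq_ne d hd
  simp [hz, h1, h2, h3]

theorem rank_sub_le {m n k l : Type*} [Fintype m] [Fintype n] [Fintype k] [Fintype l]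
    (M : Matrix m n ℂ) (f : k → m) (g : l → n) : (M.submatrix f g).rank ≤ M.rank := by
  classical
  have : M.submatrix f g =
      (1 : Matrix m m ℂ).submatrix f id * M * (1 : Matrix n n ℂ).submatrix id g := by
    ext a b
    simp [Matrix.mul_apply, Matrix.one_apply]
  rw [this]
  exact (Matrix.rank_mul_le_left _ _).trans (Matrix.rank_mul_le_right _ _)

theorem combM_le_rank (h d μ : ℕ) (r rc : ℤ) (hr : r ≠ 0) (hrc : rc ≠ 0) (hd : 3 ≤ d)
    (hhd : 2 * h + 2 ≤ h * d)
    (hV : ∀ v : Fin (h + 1) → Fin (d - 1), ∑ e, (v e).1 = d →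
      (∃ e : Fin (h + 1), μ ≤ e.1 ∧ 1 ≤ (v e).1) ∧
      (∃ e : Fin (h + 1), μ ≤ e.1 ∧ (v e).1 + 1 ≤ d - 2)) :
    2 * Fintype.card (VSet h d) ≤ (combM h d μ r rc).rank := by
  classical
  have h1 : ∀ v : VSet h d, ∃ e : Fin (h + 1), μ ≤ e.1 ∧ 1 ≤ (v.1 e).1 := fun v => (hV v.1 v.2).1
  have h2 : ∀ v : VSet h d, ∃ e : Fin (h + 1), μ ≤ e.1 ∧ (v.1 e).1 + 1 ≤ d - 2 :=
    fun v => (hV v.1 v.2).2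
  choose ec hec1 hec2 using h1
  choose er her1 her2 using h2
  have rowsum : ∀ v : VSet h d, ∑ e, (d - 2 - (v.1 e).1) = h * d - (2 * h + 2) := by
    intro v
    have e1 : ∑ e, (d - 2 - (v.1 e).1) + ∑ e, (v.1 e).1 = (h + 1) * (d - 2) := by
      rw [← Finset.sum_add_distrib]
      rw [Finset.sum_congr rfl (g := fun _ => d - 2)]
      · simp
      · intro e _
        have := (v.1 e).2
        omega
    rw [v.2] at e1
    obtain ⟨c, rfl⟩ : ∃ c, d = c + 3 := ⟨d - 3, by omega⟩
    have e2 : c + 3 - 2 = c + 1 := by omega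
    rw [e2] at e1 ⊢
    have e3 : (h + 1) * (c + 1) + 2 * h + 2 = h * (c + 3) + (c + 3) := by ring
    omega
  let row : VSet h d × Fin 2 → IdxSet h d (h * d - (2 * h + 2)) := fun vk =>
    mkIdx h d _ (fun e => if e = er vk.1 then vk.2.1 else 0)
      (fun e => (d - 2 - (vk.1.1 e).1) - (if e = er vk.1 then vk.2.1 else 0))
      (by intro e; have := vk.2.2; split_ifs <;> omega)
      (by intro e; omega)
      (by
        rw [← rowsum vk.1]
        refine Finset.sum_congr rfl fun e _ => ?_
        have := vk.2.2
        split_ifs with he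
        · have := her2 vk.1
          rw [he]; omega
        · omega)
  let col : VSet h d × Fin 2 → IdxSet h d d := fun vk =>
    mkIdx h d _ (fun e => if e = ec vk.1 then vk.2.1 else 0)
      (fun e => (vk.1.1 e).1 - (if e = ec vk.1 then vk.2.1 else 0))
      (by intro e; have := vk.2.2; split_ifs <;> omega)
      (by intro e; have := (vk.1.1 e).2; omega)
      (by
        refine Eq.trans ?_ vk.1.2
        refine Finset.sum_congr rfl fun e _ => ?_
        have := vk.2.2
        split_ifs with he
        · have := hec2 vk.1
          rw [he]; omega
        · omega)
  have row_ev : ∀ vk e, ((row vk).1 (evIdx h e)).1 = if e = er vk.1 then vk.2.1 else 0 :=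
    fun vk e => mkIdx_ev h d _ _ _ _ _ _ e
  have row_od : ∀ vk e, ((row vk).1 (odIdx h e)).1 =
      (d - 2 - (vk.1.1 e).1) - (if e = er vk.1 then vk.2.1 else 0) :=
    fun vk e => mkIdx_od h d _ _ _ _ _ _ e
  have col_ev : ∀ vk e, ((col vk).1 (evIdx h e)).1 = if e = ec vk.1 then vk.2.1 else 0 :=
    fun vk e => mkIdx_ev h d _ _ _ _ _ _ e
  have col_od : ∀ vk e, ((col vk).1 (odIdx h e)).1 =
      (vk.1.1 e).1 - (if e = ec vk.1 then vk.2.1 else 0) :=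
    fun vk e => mkIdx_od h d _ _ _ _ _ _ e
  have row_s : ∀ vk e, ((row vk).1 (evIdx h e)).1 + ((row vk).1 (odIdx h e)).1 =
      d - 2 - (vk.1.1 e).1 := by
    intro vk e
    rw [row_ev, row_od]
    have := vk.2.2
    split_ifs with he
    · have := her2 vk.1
      rw [he]; omega
    · omega
  have col_s : ∀ vk e, ((col vk).1 (evIdx h e)).1 + ((col vk).1 (odIdx h e)).1 =
      (vk.1.1 e).1 := by
    intro vk e
    rw [col_ev, col_od]
    have := vk.2.2
    split_ifs with he
    · have := hec2 vk.1
      rw [he]; omega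
    · omega
  let D : Matrix (VSet h d × Fin 2) (VSet h d × Fin 2) ℂ :=
    Matrix.of fun x y => if x.1 = y.1 then Qmat h d μ r rc x.2 y.2 else 0
  have hsub : (combM h d μ r rc).submatrix row col = D := by
    ext x y
    rw [Matrix.submatrix_apply, combM_apply]
    have hiff : (∀ e : Fin (h + 1), (((row x).1 (evIdx h e)).1 + ((col y).1 (evIdx h e)).1) +
          (((row x).1 (odIdx h e)).1 + ((col y).1 (odIdx h e)).1) = d - 2) ↔ x.1 = y.1 := by
      constructor
      · intro hh
        apply Subtype.ext
        funext e
        apply Fin.ext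
        have a1 := hh e
        have a2 := row_s x e
        have a3 := col_s y e
        have := (x.1.1 e).2
        omega
      · intro hh e
        have a2 := row_s x e
        have a3 := col_s y e
        rw [← hh] at a3
        have := (x.1.1 e).2
        omega
    simp only [hiff, D, Matrix.of_apply]
    refine if_congr Iff.rfl ?_ rfl
    have key : ∀ k, (∑ e : Fin (h + 1),
          (((row x).1 (evIdx h e)).1 + ((col y).1 (evIdx h e)).1 + 1) * (1 + 2 * wt h μ k e)) =
          (∑ e : Fin (h + 1), (1 + 2 * wt h μ k e)) + (x.2.1 * (1 + 2 * wt h μ k (er x.1)) +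
            y.2.1 * (1 + 2 * wt h μ k (ec y.1))) := by
      intro k
      simp only [row_ev, col_ev, add_mul, Finset.sum_add_distrib, ite_mul, zero_mul, one_mul,
        Finset.sum_ite_eq', Finset.mem_univ, if_true]
      ring
    have w1 : wt h μ 1 (er x.1) = 1 := by
      have := her1 x.1
      simp [wt, this]
    have w2 : wt h μ 1 (ec y.1) = 1 := by
      have := hec1 y.1
      simp [wt, this]
    have w3 : ∀ e, wt h μ 0 e = 0 := fun e => by simp [wt]
    rw [key 0, key 1, w1, w2, w3 (er x.1), w3 (ec y.1), Qmat, Matrix.of_apply, pow_add, pow_add]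
    ring_nf
  have hdet : IsUnit D := by
    have hQ : IsUnit (Qmat h d μ r rc).det := (Qmat_det h d μ r rc hr hrc hd).isUnit
    let E : Matrix (VSet h d × Fin 2) (VSet h d × Fin 2) ℂ :=
      Matrix.of fun x y => if x.1 = y.1 then (Qmat h d μ r rc)⁻¹ x.2 y.2 else 0
    have hDE : D * E = 1 := by
      ext x y
      rw [Matrix.mul_apply, Fintype.sum_prod_type, Finset.sum_eq_single x.1]
      · have := congrFun (congrFun (Matrix.mul_nonsing_inv _ hQ) x.2) y.2
        rw [Matrix.mul_apply] at this
        simp only [D, E, Matrix.of_apply, if_true]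
        by_cases hxy : x.1 = y.1
        · simp only [hxy, if_true, this, Matrix.one_apply, Prod.ext_iff, true_and]
        · simp [hxy, Prod.ext_iff]
      · intro v _ hv
        simp [D, Ne.symm hv]
      · simp
    exact IsUnit.of_mul_eq_one E hDE
  have hrk := rank_sub_le (combM h d μ r rc) row col
  rw [hsub, Matrix.rank_of_isUnit D hdet] at hrk
  simpa [mul_comm] using hrk

/-- Computable form of the coefficient. -/
def Cfun (n d x y s t : ℕ) : ℤ :=
  ∑ a ∈ Finset.range (s + 1), ∑ b ∈ Finset.range (t + 1),
    (s.choose a : ℤ) * (t.choose b : ℤ) * ((-1) ^ (a + b) *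
      if a * x + b * y ≤ d then ((n + 1 + d - (a * x + b * y)).choose (n + 1) : ℤ) else 0)

theorem sum_powerset_two (s t : ℕ) (F : ℕ → ℕ → ℤ) :
    ∑ T : Finset (Fin s ⊕ Fin t), F T.toLeft.card T.toRight.card =
      ∑ a ∈ Finset.range (s + 1), ∑ b ∈ Finset.range (t + 1),
        (s.choose a : ℤ) * (t.choose b : ℤ) * F a b := by
  have e1 : ∑ T : Finset (Fin s ⊕ Fin t), F T.toLeft.card T.toRight.card =
      ∑ p : Finset (Fin s) × Finset (Fin t), F p.1.card p.2.card :=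
    Fintype.sum_equiv Finset.sumEquiv.toEquiv _ _ (fun T => rfl)
  rw [e1, Fintype.sum_prod_type]
  have e2 : ∀ (k : ℕ) (G : ℕ → ℤ), ∑ T : Finset (Fin k), G T.card =
      ∑ a ∈ Finset.range (k + 1), (k.choose a : ℤ) * G a := by
    intro k G
    have := Finset.sum_powerset_apply_card G (x := (Finset.univ : Finset (Fin k)))
    simpa using this
  rw [e2 s (fun a => ∑ T : Finset (Fin t), F a T.card)]
  refine Finset.sum_congr rfl fun a _ => ?_
  rw [e2 t (F a), Finset.mul_sum]
  refine Finset.sum_congr rfl fun b _ => ?_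
  ring

theorem Ccoef_sum (n d : ℕ) {s : ℕ} (α : Fin s → ℕ) :
    Ccoef n d α = ∑ T : Finset (Fin s), (-1) ^ T.card *
      if ∑ i ∈ T, α i ≤ d then ((n + 1 + d - ∑ i ∈ T, α i).choose (n + 1) : ℤ) else 0 := by
  classical
  set G : Finset (Fin s) → ℤ := fun T =>
    if ∑ i ∈ T, α i ≤ d then ((n + 1 + d - ∑ i ∈ T, α i).choose (n + 1) : ℤ) else 0 with hG
  have e1 : ∑ T : Finset (Fin s), (-1) ^ T.card * G T =
      ∑ k ∈ Finset.range (s + 1), ∑ T : Finset (Fin s) with T.card = k, (-1) ^ T.card * G T := by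
    rw [Finset.sum_fiberwise_of_maps_to]
    intro T _
    have := Finset.card_le_univ T
    simp at this ⊢
    omega
  rw [e1, Finset.sum_range_eq_add_Ico _ (by omega)]
  have e0 : ∑ T : Finset (Fin s) with T.card = 0, (-1) ^ T.card * G T =
      ((n + 1 + d).choose (n + 1) : ℤ) := by
    have : (Finset.univ.filter fun T : Finset (Fin s) => T.card = 0) = {∅} := by
      ext T; simp
    rw [this]
    simp [hG]
  rw [e0, Ccoef, sub_eq_add_neg, ← Finset.sum_neg_distrib]
  congr 1
  refine Finset.sum_congr ?_ ?_
  · rfl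
  · intro k hk
    have hk1 : 1 ≤ k := by simp at hk; omega
    obtain ⟨k, rfl⟩ : ∃ c, k = c + 1 := ⟨k - 1, by omega⟩
    rw [← Finset.filter_filter, Finset.sum_filter, Finset.mul_sum, ← Finset.sum_neg_distrib]
    refine Finset.sum_congr rfl fun T hT => ?_
    simp only [Finset.mem_filter, Finset.mem_univ, true_and] at hT
    rw [hT]
    by_cases hle : ∑ i ∈ T, α i ≤ d <;> simp [hG, pow_succ, hle]

theorem Ccoef_two (n d x y s t : ℕ) : Ccoef n d (twoBlock x y s t) = Cfun n d x y s t := by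
  classical
  rw [Ccoef_sum, Cfun, ← sum_powerset_two s t (fun a b => (-1) ^ (a + b) *
      if a * x + b * y ≤ d then ((n + 1 + d - (a * x + b * y)).choose (n + 1) : ℤ) else 0)]
  refine (Fintype.sum_equiv (Equiv.finsetCongr finSumFinEquiv) _ _ fun T => ?_).symm
  have hc : ((Equiv.finsetCongr finSumFinEquiv) T).card = T.toLeft.card + T.toRight.card := by
    rw [Finset.card_toLeft_add_card_toRight]; simp [Equiv.finsetCongr]
  have hs : ∑ i ∈ (Equiv.finsetCongr finSumFinEquiv) T, twoBlock x y s t i =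
      T.toLeft.card * x + T.toRight.card * y := by
    rw [Equiv.finsetCongr_apply, Finset.sum_map]
    conv_lhs => rw [← Finset.toLeft_disjSum_toRight (u := T)]
    rw [Finset.sum_disjSum]
    simp [twoBlock]
  rw [hc, hs]

/-- Everything to be checked on a single triple. -/
theorem rank_of_data (h d μ : ℕ) (r rc : ℤ) (hr : r ≠ 0) (hrc : rc ≠ 0) (hd : 3 ≤ d)
    (hhd : 2 * h + 2 ≤ h * d)
    (hV : ∀ v : Fin (h + 1) → Fin (d - 1), ∑ e, (v e).1 = d →
      (∃ e : Fin (h + 1), μ ≤ e.1 ∧ 1 ≤ (v e).1) ∧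
      (∃ e : Fin (h + 1), μ ≤ e.1 ∧ (v e).1 + 1 ≤ d - 2))
    (hK : 2 * (Fintype.card (VSet h d) : ℤ) = 2 * Cfun (2 * h) d 1 (d - 1) (h + 1) (h + 1) -
      Cfun (2 * h) d 1 (d - 1) (2 * h + 2 - μ) μ) :
    ((((r : ℂ) • pmat h d (Pvec h d) + (rc : ℂ) • pmat h d (PcheckVec h d μ)).rank : ℤ))
      = Kdef h d μ := by
  have h1 : (combM h d μ r rc).rank = 2 * Fintype.card (VSet h d) :=
    le_antisymm (combM_rank_le h d μ r rc) (combM_le_rank h d μ r rc hr hrc hd hhd hV)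
  change ((combM h d μ r rc).rank : ℤ) = _
  rw [h1, Kdef, Ccoef_two, Ccoef_two, ← hK]
  push_cast
  ring

/-- For the triples `(n,d,m)` of Theorem `27.03.17` and all nonzero integers `r, ř`,
the rank of `r·[P_{i+j}] + ř·[(P̌_m)_{i+j}]` equals `K^d_n(m)`. -/
theorem rank_combination_eq_K (h d μ : ℕ) (hin : TripleList h d μ)
    (r rc : ℤ) (hr : r ≠ 0) (hrc : rc ≠ 0) :
    ((((r : ℂ) • pmat h d (Pvec h d) + (rc : ℂ) • pmat h d (PcheckVec h d μ)).rank : ℤ))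
      = Kdef h d μ := by
  rcases hin with ⟨rfl, h5, h14, rfl⟩ | ⟨rfl, hc⟩ | ⟨rfl, hc⟩ | ⟨rfl, rfl, hc⟩ | ⟨rfl, rfl, hc⟩
  · interval_cases d <;>
      exact rank_of_data _ _ _ r rc hr hrc (by norm_num) (by norm_num) (by decide +kernel)
        (by decide +kernel)
  · rcases hc with ⟨rfl, rfl⟩ | ⟨rfl, rfl⟩ | ⟨rfl, rfl⟩ | ⟨rfl, rfl⟩ | ⟨rfl, rfl⟩ <;>
      exact rank_of_data _ _ _ r rc hr hrc (by norm_num) (by norm_num) (by decide +kernel)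
        (by decide +kernel)
  · rcases hc with ⟨rfl, rfl⟩ | ⟨rfl, rfl⟩ | ⟨rfl, rfl⟩ <;>
      exact rank_of_data _ _ _ r rc hr hrc (by norm_num) (by norm_num) (by decide +kernel)
        (by decide +kernel)
  · rcases hc with rfl | rfl <;>
      exact rank_of_data _ _ _ r rc hr hrc (by norm_num) (by norm_num) (by decide +kernel)
        (by decide +kernel)
  · rcases hc with rfl | rfl | rfl <;>
      exact rank_of_data _ _ _ r rc hr hrc (by norm_num) (by norm_num) (by decide +kernel)
        (by decide +kernel)
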